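/- Let k and k′ be positive integers, let λ_1, …, λ_k be distinct positive reals with positive weights p_1, …, p_k summing to 1, and let λ′_1, …, λ′_{k′} be distinct positive reals with positive weights p′_1, …, p′_{k′} summing to 1. If the two finite Poisson mixtures coincide as distributions on the nonnegative integers, i.e., Σ_{i=1}^k p_i e^{−λ_i} λ_i^m / m! = Σ_{j=1}^{k′} p′_j e^{−λ′_j} (λ′_j)^m / m! for every integer m ≥ 0, then k = k′ and, after a permutation of indices, λ_i = λ′_i and p_i = p′_i for all i = 1, …, k. -/

import Mathlib

open Polynomial in
/-- Two finite families of weighted points with the same moments give the same total weight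
to every point. -/
theorem sum_filter_eq_of_moments_eq {ι κ R : Type*} [Fintype ι] [Fintype κ] [CommRing R]
    [IsDomain R] [DecidableEq R] {a x : ι → R} {b y : κ → R}
    (h : ∀ m : ℕ, ∑ i, a i * x i ^ m = ∑ j, b j * y j ^ m) (t : R) :
    ∑ i with x i = t, a i = ∑ j with y j = t, b j := by
  have eval_eq (q : R[X]) : ∑ i, a i * q.eval (x i) = ∑ j, b j * q.eval (y j) := by
    induction q using Polynomial.induction_on' with
    | add q r hq hr => simp only [eval_add, mul_add, Finset.sum_add_distrib, hq, hr]
    | monomial m c =>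
      simp only [eval_monomial, mul_left_comm _ c, ← Finset.mul_sum, h]
  let S := (Finset.univ.image x ∪ Finset.univ.image y).erase t
  let q : R[X] := ∏ s ∈ S, (X - C s)
  have eval_ne_zero : q.eval t ≠ 0 := by
    simp only [q, eval_prod, eval_sub, eval_X, eval_C, Finset.prod_ne_zero_iff]
    intro s hs
    exact sub_ne_zero.2 (Finset.ne_of_mem_erase hs).symm
  have eval_eq_zero {s : R} (hs : s ∈ S) : q.eval s = 0 := by
    simp only [q, eval_prod, eval_sub, eval_X, eval_C]
    exact Finset.prod_eq_zero hs (sub_self s)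
  have left : ∑ i, a i * q.eval (x i) = (∑ i with x i = t, a i) * q.eval t := by
    rw [Finset.sum_mul, Finset.sum_filter]
    refine Finset.sum_congr rfl fun i _ => ?_
    split_ifs with hi
    · rw [hi]
    · rw [eval_eq_zero (by simp [S, hi]), mul_zero]
  have right : ∑ j, b j * q.eval (y j) = (∑ j with y j = t, b j) * q.eval t := by
    rw [Finset.sum_mul, Finset.sum_filter]
    refine Finset.sum_congr rfl fun j _ => ?_
    split_ifs with hj
    · rw [hj]
    · rw [eval_eq_zero (by simp [S, hj]), mul_zero]
  exact mul_right_cancel₀ eval_ne_zero (left ▸ right ▸ eval_eq q)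

/-- If two finite families of distinct points with nonzero weights have the same moments, every
weighted point of the first family occurs in the second. -/
theorem exists_eq_of_moments_eq {ι κ R : Type*} [Fintype ι] [Fintype κ] [CommRing R]
    [IsDomain R] {a x : ι → R} {b y : κ → R} (hx : Function.Injective x)
    (hy : Function.Injective y) (ha : ∀ i, a i ≠ 0)
    (h : ∀ m : ℕ, ∑ i, a i * x i ^ m = ∑ j, b j * y j ^ m) (i : ι) :
    ∃ j, y j = x i ∧ b j = a i := by
  classical
  have hsum := sum_filter_eq_of_moments_eq h (x i)
  simp only [hx.eq_iff, Finset.sum_filter, Finset.sum_ite_eq', Finset.mem_univ, if_true] at hsum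
  obtain ⟨j, hj⟩ : ∃ j, y j = x i := by
    by_contra! hne
    exact ha i (by simpa [hne] using hsum)
  refine ⟨j, hj, ?_⟩
  simpa [← hj, hy.eq_iff] using hsum.symm

/-- Identifiability of finite Poisson mixtures: if two finite mixtures of Poisson
distributions (with distinct positive means and positive weights summing to one)
coincide as distributions on `ℕ`, then they have the same number of components and,
up to a permutation of indices, the same atoms and weights. -/
theorem stmt_8 (k k' : ℕ) (hk : 0 < k) (hk' : 0 < k')
    (lam : Fin k → ℝ) (p : Fin k → ℝ) (lam' : Fin k' → ℝ) (p' : Fin k' → ℝ)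
    (hlam_pos : ∀ i, 0 < lam i) (hlam_inj : Function.Injective lam)
    (hp_pos : ∀ i, 0 < p i) (hp_sum : ∑ i, p i = 1)
    (hlam'_pos : ∀ j, 0 < lam' j) (hlam'_inj : Function.Injective lam')
    (hp'_pos : ∀ j, 0 < p' j) (hp'_sum : ∑ j, p' j = 1)
    (hmix : ∀ m : ℕ, ∑ i, p i * (Real.exp (-lam i) * lam i ^ m / m.factorial)
        = ∑ j, p' j * (Real.exp (-lam' j) * lam' j ^ m / m.factorial)) :
    k = k' ∧ ∃ e : Fin k ≃ Fin k', ∀ i, lam' (e i) = lam i ∧ p' (e i) = p i := by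
  have moments (m : ℕ) : ∑ i, (p i * Real.exp (-lam i)) * lam i ^ m
      = ∑ j, (p' j * Real.exp (-lam' j)) * lam' j ^ m := by
    have hm := hmix m
    simp only [← mul_div_assoc, ← mul_assoc, ← Finset.sum_div] at hm
    exact (div_left_inj' (by positivity)).1 hm
  choose f hf_lam hf_weight using exists_eq_of_moments_eq hlam_inj hlam'_inj
    (fun i => (mul_pos (hp_pos i) (Real.exp_pos _)).ne') moments
  choose g hg_lam _ using exists_eq_of_moments_eq hlam'_inj hlam_inj
    (fun j => (mul_pos (hp'_pos j) (Real.exp_pos _)).ne') fun m => (moments m).symm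
  let e : Fin k ≃ Fin k' :=
    { toFun := f
      invFun := g
      left_inv := fun i => hlam_inj ((hg_lam _).trans (hf_lam i))
      right_inv := fun j => hlam'_inj ((hf_lam _).trans (hg_lam j)) }
  refine ⟨by simpa using Fintype.card_congr e, e, fun i => ⟨hf_lam i, ?_⟩⟩
  have hw := hf_weight i
  rw [hf_lam i] at hw
  exact mul_right_cancel₀ (Real.exp_ne_zero _) hw
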